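/- There exist sets S, U ⊆ ω₃ and, for each α ∈ S, a set C_α, such that: (a) S ⊆ S³₀ ∪ S³₁ and S ∩ S³₁ is stationary in ω₃; (b) U ⊆ S³₀ is stationary in ω₃ and S ∩ U = ∅; (c) for all α ∈ S, C_α ⊆ α ∩ S is closed in α and has order type ≤ ω₁; (d) for all α ∈ S, if β ∈ C_α then C_β = C_α ∩ β; (e) for all α ∈ S ∩ S³₁, C_α is unbounded in α. -/

import Mathlib

noncomputable section

def omega1 : Ordinal.{0} := (Cardinal.aleph 1).ord
def omega3 : Ordinal.{0} := (Cardinal.aleph 3).ord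

/-- `S³₀`: the ordinals below ω₃ of cofinality ω. -/
def S30 : Set Ordinal.{0} := {α | α < omega3 ∧ α.cof = Cardinal.aleph0}
/-- `S³₁`: the ordinals below ω₃ of cofinality ω₁. -/
def S31 : Set Ordinal.{0} := {α | α < omega3 ∧ α.cof = Cardinal.aleph 1}

/-- `C` is closed in `δ` (order topology): every `α < δ` which is a limit of
elements of `C` below it belongs to `C`. -/
def ClosedIn (C : Set Ordinal.{0}) (δ : Ordinal.{0}) : Prop :=
  ∀ α < δ, α ≠ 0 → (∀ β < α, ∃ γ ∈ C, β < γ ∧ γ < α) → α ∈ C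

/-- `C` is unbounded in `δ`. -/
def UnbddIn (C : Set Ordinal.{0}) (δ : Ordinal.{0}) : Prop :=
  ∀ β < δ, ∃ γ ∈ C, β < γ ∧ γ < δ

/-- `X` is stationary in `δ`: it meets every closed unbounded subset of `δ`. -/
def StationaryIn (X : Set Ordinal.{0}) (δ : Ordinal.{0}) : Prop :=
  ∀ C : Set Ordinal.{0}, C ⊆ Set.Iio δ → ClosedIn C δ → UnbddIn C δ → (X ∩ C).Nonempty

/-- `C ⊆ α` is closed in `α`: it contains the supremum of each of its nonempty
subsets that are bounded in `α`. -/
def ClosedSupIn (C : Set Ordinal.{0}) (α : Ordinal.{0}) : Prop :=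
  ∀ s ⊆ C, s.Nonempty → (∃ β < α, ∀ x ∈ s, x ≤ β) → sSup s ∈ C

/-- The order type of a set of ordinals. -/
def otype (C : Set Ordinal.{0}) : Ordinal.{1} :=
  Ordinal.type ((· < ·) : ↥C → ↥C → Prop)

open Ordinal Cardinal Set Order

theorem iSup_Iio_add_one_lt {o ν : Ordinal.{0}} (hν : ν.card < o.cof) {f : Iio ν → Ordinal.{0}}
    (hf : ∀ i, f i < o) : ⨆ i, f i + 1 < o := by
  apply lift_iSup_add_one_lt_of_lt_cof _ hf
  rw [Cardinal.mk_Iio_ordinal, ← lift_cof, Cardinal.lift_lift, Cardinal.lift_lt]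
  exact hν

theorem exists_bound_of_countable {o : Ordinal.{0}} (ho : ℵ₀ < o.cof) {s : Set Ordinal.{0}}
    (hs : s.Countable) (hso : ∀ x ∈ s, x < o) : ∃ b < o, ∀ x ∈ s, x < b := by
  obtain rfl | hne := s.eq_empty_or_nonempty
  · exact ⟨0, Ordinal.cof_pos.1 (aleph0_pos.trans ho), by simp⟩
  obtain ⟨f, rfl⟩ := hs.exists_eq_range hne
  refine ⟨⨆ i, f i + 1, iSup_add_one_lt_of_lt_cof (by simpa using ho) fun i ↦ hso _ ⟨i, rfl⟩, ?_⟩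
  rintro _ ⟨i, rfl⟩
  exact Ordinal.lt_iSup_add_one f i

theorem cof_eq_aleph0_of_countable {o : Ordinal.{0}} (ho : o ≠ 0) {s : Set Ordinal.{0}}
    (hs : s.Countable) (hso : UnbddIn s o) : o.cof = ℵ₀ := by
  apply le_antisymm
  · by_contra! h
    obtain ⟨b, hb, hb'⟩ := exists_bound_of_countable h (hs.mono inter_subset_left)
      (s := s ∩ Iio o) fun x hx ↦ hx.2
    obtain ⟨γ, hγ, hbγ, hγo⟩ := hso b hb
    exact (hb' γ ⟨hγ, hγo⟩).not_gt hbγ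
  · rw [Ordinal.aleph0_le_cof_iff, Ordinal.one_lt_cof_iff, Ordinal.isSuccLimit_iff]
    refine ⟨ho, ?_⟩
    rw [isSuccPrelimit_iff_succ_lt]
    intro b hb
    obtain ⟨γ, -, hbγ, hγo⟩ := hso b hb
    exact (Order.succ_le_of_lt hbγ).trans_lt hγo

theorem exists_closed_of_cof {κ μ : Cardinal.{0}} (hκ : κ.IsRegular) (hμ : μ.IsRegular)
    (hμκ : μ < κ) (G : Ordinal.{0} → Ordinal.{0} → Ordinal.{0})
    (hG : ∀ a < κ.ord, ∀ b < κ.ord, G a b < κ.ord) :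
    ∃ i < κ.ord, i.cof = μ ∧ ∀ a < i, ∀ b < i, G a b < i := by
  have hlim := isSuccLimit_ord hκ.1
  have hcard : ∀ {x : Ordinal.{0}}, x < κ.ord → x.card < κ.ord.cof := fun hx ↦ by
    rw [hκ.cof_ord]; exact lt_ord.1 hx
  let g : Ordinal.{0} → Ordinal.{0} := fun x ↦
    ⨆ a : Iio (succ x), (⨆ b : Iio (succ x), max x (G a b) + 1) + 1
  have hg : ∀ x < κ.ord, g x < κ.ord := fun x hx ↦ by
    have hx' := hlim.succ_lt hx
    exact iSup_Iio_add_one_lt (hcard hx') fun a ↦ iSup_Iio_add_one_lt (hcard hx') fun b ↦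
      max_lt hx (hG _ (lt_trans a.2 hx') _ (lt_trans b.2 hx'))
  have hgG : ∀ x, ∀ a ≤ x, ∀ b ≤ x, max x (G a b) < g x := fun x a ha b hb ↦ by
    refine lt_trans ?_ (Ordinal.lt_iSup_add_one _ (⟨a, lt_succ_of_le ha⟩ : Iio (succ x)))
    exact Ordinal.lt_iSup_add_one (fun b : Iio (succ x) ↦ max x (G a b)) ⟨b, lt_succ_of_le hb⟩
  let h : Ordinal.{0} → Ordinal.{0} := WellFoundedLT.fix fun ν h ↦
    ⨆ m : Iio ν, g (h m m.2) + 1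
  have h_eq : ∀ ν, h ν = ⨆ m : Iio ν, g (h m) + 1 := fun ν ↦ by
    simp only [h]; rw [WellFoundedLT.fix_eq]
  have h_step : ∀ {m ν}, m < ν → g (h m) < h ν := fun {m ν} hm ↦ by
    rw [h_eq ν]
    exact Ordinal.lt_iSup_add_one (fun m : Iio ν ↦ g (h m)) ⟨m, hm⟩
  have h_mono : StrictMono h := fun m ν hm ↦
    ((le_max_left _ _).trans_lt (hgG (h m) _ le_rfl _ le_rfl)).trans (h_step hm)
  have h_lt : ∀ ν < μ.ord, h ν < κ.ord := fun ν ↦ by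
    induction ν using WellFoundedLT.induction with
    | ind ν ih =>
      intro hν
      rw [h_eq]
      refine iSup_Iio_add_one_lt ?_ fun m ↦ hg _ (ih m m.2 (lt_trans m.2 hν))
      rw [hκ.cof_ord]
      exact (lt_ord.1 hν).trans hμκ
  have hμlim := isSuccLimit_ord hμ.1
  refine ⟨⨆ m : Iio μ.ord, h m + 1, iSup_Iio_add_one_lt ?_ fun m ↦ h_lt m m.2, ?_, ?_⟩
  · rwa [hκ.cof_ord, card_ord]
  · exact (cof_iSup_Iio_add_one (h_mono.comp (Subtype.strictMono_coe _))).trans hμ.cof_ord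
  · intro a ha b hb
    rw [Ordinal.lt_iSup_iff] at ha hb
    obtain ⟨m, hm⟩ := ha
    obtain ⟨n, hn⟩ := hb
    have hk : max m.1 n.1 < μ.ord := max_lt m.2 n.2
    have hak : a ≤ h (max m n) := (lt_succ_iff.1 hm).trans (h_mono.monotone (le_max_left _ _))
    have hbk : b ≤ h (max m n) := (lt_succ_iff.1 hn).trans (h_mono.monotone (le_max_right _ _))
    refine ((le_max_right _ _).trans_lt (hgG _ a hak b hbk)).trans ((h_step (lt_succ _)).trans ?_)
    exact Ordinal.lt_iSup_add_one (fun m : Iio μ.ord ↦ h m) ⟨_, hμlim.succ_lt hk⟩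

theorem isRegular_aleph_two : (ℵ_ 2).IsRegular := by
  rw [← one_add_one_eq_two]; exact isRegular_aleph_add_one 1

theorem isRegular_aleph_three : (ℵ_ 3).IsRegular := by
  rw [← two_add_one_eq_three]; exact isRegular_aleph_add_one 2

theorem exists_stationaryIn_of_cover {ι : Type} (hι : #ι ≤ ℵ_ 2) {μ : Cardinal.{0}}
    (hμ : μ.IsRegular) (hμ' : μ < ℵ_ 3) (T : ι → Set Ordinal.{0})
    (hT : ∀ α < omega3, (ℵ_ 2).ord ≤ α → α.cof = μ → ∃ x, α ∈ T x) :
    ∃ x, StationaryIn {α | (α < omega3 ∧ α.cof = μ) ∧ α ∈ T x} omega3 := by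
  have h23 : ℵ_ 2 < ℵ_ 3 := aleph_lt_aleph.2 (by norm_num)
  by_contra! H
  simp only [StationaryIn, not_forall, not_nonempty_iff_eq_empty] at H
  choose C hC₁ hC₂ hC₃ hC₄ using H
  have : ∀ x b, ∃ γ, b < omega3 → γ ∈ C x ∧ b < γ ∧ γ < omega3 := fun x b ↦ by
    by_cases hb : b < omega3
    · obtain ⟨γ, h⟩ := hC₃ x b hb
      exact ⟨γ, fun _ ↦ h⟩
    · exact ⟨0, fun h ↦ (hb h).elim⟩
  choose nxt hnxt using this
  obtain ⟨i, hi, hiμ, hcl⟩ := exists_closed_of_cof isRegular_aleph_three hμ hμ'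
    (fun a _ ↦ max (ℵ_ 2).ord (⨆ x, nxt x a + 1)) (fun a ha _ _ ↦ max_lt (ord_lt_ord.2 h23)
      (iSup_add_one_lt_of_lt_cof (by rw [isRegular_aleph_three.cof_ord]; exact hι.trans_lt h23)
        fun x ↦ (hnxt x a ha).2.2))
  have hi0 : i ≠ 0 := by
    rintro rfl
    rw [Ordinal.cof_zero] at hiμ
    exact hμ.ne_zero hiμ.symm
  have h2i : (ℵ_ 2).ord < i :=
    (le_max_left _ _).trans_lt (hcl 0 (pos_iff_ne_zero.2 hi0) 0
      (pos_iff_ne_zero.2 hi0))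
  obtain ⟨x, hx⟩ := hT i hi h2i.le hiμ
  have : i ∈ C x := by
    refine hC₂ x i hi hi0 fun b hb ↦ ?_
    have := hnxt x b (hb.trans hi)
    refine ⟨_, this.1, this.2.1, ?_⟩
    refine (Ordinal.lt_iSup_add_one (fun x ↦ nxt x b) x).trans ?_
    exact (le_max_right _ _).trans_lt (hcl b hb b hb)
  exact (hC₄ x).subset ⟨⟨⟨hi, hiμ⟩, hx⟩, this⟩

/-- A coherent system of sets `A α ⊆ α` of size at most `ℵ₁` for `α ∈ N`, cofinal in `α` whenever
`cof α ≤ ℵ₁` and closed under limits of cofinality `ω`. -/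
structure CoherentSystem (N : Set Ordinal.{0}) (A : Ordinal.{0} → Set Ordinal.{0}) : Prop where
  subset_Iio : ∀ α, A α ⊆ Iio α
  small : ∀ α < omega3, ∃ i < (ℵ_ 2).ord, ∃ d : Ordinal.{0} → Ordinal.{0}, A α ⊆ d '' Iio i
  mem : ∀ α ∈ N, ∀ β ∈ A α, β ∈ N
  coherent : ∀ α ∈ N, ∀ β ∈ A α, A β = A α ∩ Iio β
  cofinal : ∀ α ∈ N, α < omega3 → α ≠ 0 → α.cof ≤ ℵ_ 1 → ∀ β < α, ∃ γ ∈ A α, β ≤ γ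
  closed : ∀ α ∈ N, α < omega3 → ∀ β < α, β.cof = ℵ₀ →
    (∀ b < β, ∃ γ ∈ A α, b < γ ∧ γ < β) → β ∈ A α

theorem exists_enumeration : ∃ e d : Ordinal.{0} → Ordinal.{0} → Ordinal.{0},
    (∀ x y, e x y < (ℵ_ 2).ord) ∧ (∀ x < omega3, ∀ y < x, d x (e x y) = y) ∧
    ∀ x ξ, d x ξ ≤ x := by
  have h0 : 0 < (ℵ_ 2).ord := isRegular_aleph_two.ord_pos
  have : ∀ x : Ordinal.{0}, ∃ f : Ordinal.{0} → Ordinal.{0},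
      (∀ y, f y < (ℵ_ 2).ord) ∧ (x < omega3 → InjOn f (Iio x)) := fun x ↦ by
    by_cases hx : x < omega3
    · have hc : #x.ToType ≤ #(ℵ_ 2).ord.ToType := by
        have h : x.card < ℵ_ 3 := lt_ord.1 hx
        rw [← two_add_one_eq_three, ← succ_aleph, lt_succ_iff] at h
        simpa using h
      obtain ⟨g⟩ := hc
      refine ⟨fun y ↦ if h : y < x then (ToType.mk.symm (g (ToType.mk ⟨y, h⟩))).1 else 0,
        fun y ↦ ?_, fun _ y hy z hz hyz ↦ ?_⟩
      · dsimp only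
        split_ifs
        · exact (ToType.mk.symm _).2
        · exact h0
      · simp only [mem_Iio] at hy hz
        simp only [hy, hz, dif_pos] at hyz
        have := g.injective (ToType.mk.symm.injective (Subtype.ext hyz))
        exact congrArg Subtype.val (ToType.mk.injective this)
    · exact ⟨fun _ ↦ 0, fun _ ↦ h0, fun h ↦ (hx h).elim⟩
  choose e he₁ he₂ using this
  have : ∀ x ξ, ∃ z ≤ x, x < omega3 → ∀ y < x, e x y = ξ → z = y := fun x ξ ↦ by
    by_cases h : ∃ y < x, e x y = ξ
    · obtain ⟨y, hy, rfl⟩ := h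
      exact ⟨y, hy.le, fun hx z hz hzy ↦ he₂ x hx hy hz hzy.symm⟩
    · exact ⟨0, zero_le, fun _ y hy hxy ↦ (h ⟨y, hy, hxy⟩).elim⟩
  choose d hd₁ hd₂ using this
  exact ⟨e, d, he₁, fun x hx y hy ↦ hd₂ _ _ hx y hy rfl, hd₁⟩

theorem exists_ladder : ∃ c : Ordinal.{0} → Ordinal.{0} → Ordinal.{0},
    (∀ x ξ, c x ξ ≤ x) ∧
    ∀ x ≠ 0, x.cof ≤ ℵ_ 1 → ∀ y < x, ∃ ξ < (ℵ_ 1).ord, y ≤ c x ξ ∧ c x ξ < x := by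
  have : ∀ x : Ordinal.{0}, ∃ f : Ordinal.{0} → Ordinal.{0}, (∀ ξ, f ξ ≤ x) ∧
      (x.cof ≤ ℵ_ 1 → ∀ y < x, ∃ ξ < (ℵ_ 1).ord, y ≤ f ξ ∧ f ξ < x) := fun x ↦ by
    obtain ⟨f, hf⟩ := exists_isFundamentalSeq (o := x) rfl
    refine ⟨fun ξ ↦ if h : ξ < x.cof.ord then (f ⟨ξ, h⟩).1 else 0, fun ξ ↦ ?_, fun hx y hy ↦ ?_⟩
    · dsimp only
      split_ifs with h
      · exact (f ⟨ξ, h⟩).2.le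
      · exact zero_le
    · obtain ⟨_, ⟨ξ, rfl⟩, h⟩ := hf.isCofinal_range ⟨y, hy⟩
      refine ⟨ξ, ξ.2.trans_le (ord_le_ord.2 hx), ?_⟩
      have : ξ.1 < x.cof.ord := ξ.2
      simp only [this, dif_pos]
      exact ⟨h, (f ξ).2⟩
  choose c hc₁ hc₂ using this
  exact ⟨c, hc₁, fun x _ ↦ hc₂ x⟩

theorem exists_bounding {e d : Ordinal.{0} → Ordinal.{0} → Ordinal.{0}}
    (hd : ∀ x < omega3, ∀ y < x, d x (e x y) = y) :
    ∃ p : Ordinal.{0} → Ordinal.{0} → Ordinal.{0}, (∀ x j, p x j ≤ x) ∧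
    ∀ x < omega3, x.cof = ℵ_ 2 → ∀ j < (ℵ_ 2).ord,
      p x j < x ∧ ∀ y < x, e x y < j → y < p x j := by
  have : ∀ x j : Ordinal.{0}, ∃ q ≤ x, (x < omega3 → x.cof = ℵ_ 2 → j < (ℵ_ 2).ord →
      q < x ∧ ∀ y < x, e x y < j → y < q) := fun x j ↦ by
    by_cases h : x < omega3 ∧ x.cof = ℵ_ 2 ∧ j < (ℵ_ 2).ord
    · obtain ⟨hx, hcof, hj⟩ := h
      have hx0 : 0 < x := by
        rw [← Ordinal.cof_pos, hcof]; exact isRegular_aleph_two.pos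
      have hlt : ⨆ ξ : Iio j, (if d x ξ < x then d x ξ else 0) + 1 < x := by
        refine iSup_Iio_add_one_lt (by rw [hcof]; exact lt_ord.1 hj) fun ξ ↦ ?_
        split_ifs with h
        exacts [h, hx0]
      refine ⟨_, hlt.le, fun _ _ _ ↦ ⟨hlt, fun y hy hyj ↦ ?_⟩⟩
      refine lt_of_eq_of_lt ?_ (Ordinal.lt_iSup_add_one _ (⟨e x y, hyj⟩ : Iio j))
      simp [hd x hx y hy, hy]
    · exact ⟨0, zero_le, fun h₁ h₂ h₃ ↦ (h ⟨h₁, h₂, h₃⟩).elim⟩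
  choose p hp₁ hp₂ using this
  exact ⟨p, hp₁, fun x hx hcof j ↦ hp₂ x j hx hcof⟩

theorem exists_hull {e d : Ordinal.{0} → Ordinal.{0} → Ordinal.{0}}
    (he : ∀ x y, e x y < (ℵ_ 2).ord) (hd : ∀ x < omega3, ∀ y < x, d x (e x y) = y)
    {n : ℕ} (G : Fin n → Ordinal.{0} → Ordinal.{0} → Ordinal.{0})
    (hG : ∀ k x y, G k x y < (ℵ_ 2).ord ∨ G k x y ≤ x) {α : Ordinal.{0}}
    (hα : (ℵ_ 2).ord ≤ α) (hα' : α < omega3) :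
    ∃ i < (ℵ_ 2).ord, i.cof = ℵ_ 1 ∧ (ℵ_ 1).ord ≤ i ∧ ∃ X : Set Ordinal.{0}, α ∈ X ∧
      X ⊆ Iio omega3 ∧ (∀ k, ∀ x ∈ X, ∀ y ∈ X, G k x y ∈ X) ∧
      ∀ ξ < (ℵ_ 2).ord, ξ ∈ X ↔ ξ < i := by
  have h12 : ℵ_ 1 < ℵ_ 2 := aleph_lt_aleph.2 one_lt_two
  have hs : succ α < omega3 := (isSuccLimit_ord (aleph0_le_aleph 3)).succ_lt hα'
  set E := e (succ α)
  set D : Ordinal.{0} → Ordinal.{0} := fun ξ ↦ min (d (succ α) ξ) α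
  have hDE : ∀ x ≤ α, D (E x) = x := fun x hx ↦ by
    simp only [D, E, hd _ hs x (lt_succ_of_le hx), min_eq_left hx]
  have hDα : ∀ ξ, D ξ ≤ α := fun ξ ↦ min_le_right _ _
  have hGα : ∀ k, ∀ x ≤ α, ∀ y, G k x y ≤ α := fun k x hx y ↦
    (hG k x y).elim (fun h ↦ h.le.trans hα) fun h ↦ h.trans hx
  obtain ⟨i, hi, hcof, hcl⟩ := exists_closed_of_cof isRegular_aleph_two isRegular_aleph_one h12
    (fun a b ↦ max (⨆ k, E (G k (D a) (D b)) + 1) (max (E a)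
      (max (if D a < (ℵ_ 2).ord then D a else 0) (max (E α) (ℵ_ 1).ord)))) (fun a ha b hb ↦ by
        refine max_lt (iSup_add_one_lt_of_lt_cof ?_ fun k ↦ he _ _) (max_lt (he _ _) (max_lt ?_
          (max_lt (he _ _) (ord_lt_ord.2 h12))))
        · rw [isRegular_aleph_two.cof_ord, mk_fin]
          exact isRegular_aleph_two.nat_lt n
        · split_ifs with h
          exacts [h, isRegular_aleph_two.ord_pos])
  have hi0 : 0 < i := by
    rw [← Ordinal.cof_pos, hcof]; exact isRegular_aleph_one.pos
  simp only [max_lt_iff] at hcl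
  refine ⟨i, hi, hcof, (hcl 0 hi0 0 hi0).2.2.2.2.le, {x | x ≤ α ∧ E x < i},
    ⟨le_rfl, (hcl 0 hi0 0 hi0).2.2.2.1⟩, fun x hx ↦ hx.1.trans_lt hα', ?_, ?_⟩
  · rintro k x ⟨hx, hxi⟩ y ⟨hy, hyi⟩
    refine ⟨hGα k x hx y, ?_⟩
    have := (hcl _ hxi _ hyi).1
    simp only [hDE x hx, hDE y hy] at this
    exact (Ordinal.lt_iSup_add_one (fun k ↦ E (G k x y)) k).trans this
  · intro ξ hξ
    refine ⟨fun ⟨hx, hxi⟩ ↦ ?_, fun h ↦ ⟨hξ.le.trans hα, (hcl ξ h ξ h).2.1⟩⟩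
    have := (hcl _ hxi _ hxi).2.2.1
    rwa [hDE ξ hx, if_pos hξ] at this

theorem exists_countable_cofinal {β : Ordinal.{0}} (hβ : β.cof = ℵ₀) :
    ∃ f : ℕ → Ordinal.{0}, (∀ n, f n < β) ∧ ∀ b < β, ∃ n, b ≤ f n := by
  obtain ⟨f, hf⟩ := exists_isFundamentalSeq (o := β) (a := ω) (by rw [hβ, ord_aleph0])
  refine ⟨fun n ↦ f ⟨n, natCast_lt_omega0 n⟩, fun n ↦ (f _).2, fun b hb ↦ ?_⟩
  obtain ⟨_, ⟨⟨ξ, hξ⟩, rfl⟩, h⟩ := hf.isCofinal_range ⟨b, hb⟩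
  obtain ⟨n, rfl⟩ := lt_omega0.1 hξ
  exact ⟨n, h⟩

theorem exists_coherentSystem : ∃ (N : Ordinal.{0} → Set Ordinal.{0})
    (A : Ordinal.{0} → Ordinal.{0} → Set Ordinal.{0}),
    ∀ α < omega3, (ℵ_ 2).ord ≤ α → ∃ i < (ℵ_ 2).ord, α ∈ N i ∧ CoherentSystem (N i) (A i) := by
  obtain ⟨e, d, he, hd, hd'⟩ := exists_enumeration
  obtain ⟨c, hc, hc'⟩ := exists_ladder
  obtain ⟨p, hp, hp'⟩ := exists_bounding hd
  let G := ![e, d, c, p]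
  let N : Ordinal.{0} → Set Ordinal.{0} := fun i ↦ {α | ∃ X : Set Ordinal.{0}, α ∈ X ∧
      X ⊆ Iio omega3 ∧ (∀ k, ∀ x ∈ X, ∀ y ∈ X, G k x y ∈ X) ∧
      ∀ ξ < (ℵ_ 2).ord, ξ ∈ X ↔ ξ < i}
  refine ⟨N, fun i α ↦ {γ | γ < α ∧ e α γ < i}, fun α hα hα2 ↦ ?_⟩
  obtain ⟨i, hi, hcof, h1i, hX⟩ := exists_hull he hd G (fun k x y ↦ by
    fin_cases k
    · exact .inl (he x y)
    · exact .inr (hd' x y)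
    · exact .inr (hc x y)
    · exact .inr (hp x y)) hα2 hα
  refine ⟨i, hi, hX, ?_⟩
  clear hX hα hα2 α
  have hmem : ∀ {X : Set Ordinal.{0}}, X ⊆ Iio omega3 →
      (∀ k, ∀ x ∈ X, ∀ y ∈ X, G k x y ∈ X) → (∀ ξ < (ℵ_ 2).ord, ξ ∈ X ↔ ξ < i) →
      ∀ α ∈ X, ∀ γ < α, e α γ < i ↔ γ ∈ X := fun {X} hX₁ hX₂ hX₃ α hα γ hγ ↦ by
    constructor
    · intro h
      have := hX₂ 1 α hα _ ((hX₃ _ (he α γ)).2 h)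
      rwa [show G 1 α (e α γ) = γ from hd α (hX₁ hα) γ hγ] at this
    · intro h
      exact (hX₃ _ (he α γ)).1 (hX₂ 0 α hα γ h)
  have hcofinal : ∀ {X : Set Ordinal.{0}}, X ⊆ Iio omega3 →
      (∀ k, ∀ x ∈ X, ∀ y ∈ X, G k x y ∈ X) → (∀ ξ < (ℵ_ 2).ord, ξ ∈ X ↔ ξ < i) →
      ∀ α ∈ X, α ≠ 0 → α.cof ≤ ℵ_ 1 → ∀ β < α, ∃ γ ∈ X, γ < α ∧ β ≤ γ := by
    intro X hX₁ hX₂ hX₃ α hα hα0 hαc β hβ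
    obtain ⟨ξ, hξ, h₁, h₂⟩ := hc' α hα0 hαc β hβ
    have hξi := hξ.trans_le h1i
    exact ⟨c α ξ, hX₂ 2 α hα ξ ((hX₃ ξ (hξi.trans hi)).2 hξi), h₂, h₁⟩
  constructor
  · exact fun α γ hγ ↦ hγ.1
  · exact fun α hα ↦ ⟨i, hi, d α, fun γ hγ ↦ ⟨e α γ, hγ.2, hd α hα γ hγ.1⟩⟩
  · rintro α ⟨X, hαX, hX₁, hX₂, hX₃⟩ β ⟨hβα, hβ⟩
    exact ⟨X, (hmem hX₁ hX₂ hX₃ α hαX β hβα).1 hβ, hX₁, hX₂, hX₃⟩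
  · rintro α ⟨X, hαX, hX₁, hX₂, hX₃⟩ β ⟨hβα, hβ⟩
    have hβX := (hmem hX₁ hX₂ hX₃ α hαX β hβα).1 hβ
    ext γ
    constructor
    · rintro ⟨hγ, hγi⟩
      have hγα := hγ.trans hβα
      exact ⟨⟨hγα, (hmem hX₁ hX₂ hX₃ α hαX γ hγα).2
        ((hmem hX₁ hX₂ hX₃ β hβX γ hγ).1 hγi)⟩, hγ⟩
    · rintro ⟨⟨hγα, hγi⟩, hγ⟩
      exact ⟨hγ, (hmem hX₁ hX₂ hX₃ β hβX γ hγ).2 ((hmem hX₁ hX₂ hX₃ α hαX γ hγα).1 hγi)⟩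
  · rintro α ⟨X, hαX, hX₁, hX₂, hX₃⟩ hα hα0 hαc β hβ
    obtain ⟨γ, hγX, hγα, hβγ⟩ := hcofinal hX₁ hX₂ hX₃ α hαX hα0 hαc β hβ
    exact ⟨γ, ⟨hγα, (hmem hX₁ hX₂ hX₃ α hαX γ hγα).2 hγX⟩, hβγ⟩
  · rintro α ⟨X, hαX, hX₁, hX₂, hX₃⟩ hα β hβα hβc hlim
    replace hlim : ∀ b < β, ∃ γ ∈ X, b < γ ∧ γ < β := fun b hb ↦ by
      obtain ⟨γ, ⟨hγα, hγi⟩, h⟩ := hlim b hb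
      exact ⟨γ, (hmem hX₁ hX₂ hX₃ α hαX γ hγα).1 hγi, h⟩
    refine ⟨hβα, (hmem hX₁ hX₂ hX₃ α hαX β hβα).2 ?_⟩
    have hne : (X ∩ Ici β).Nonempty := ⟨α, hαX, hβα.le⟩
    set γ := sInf (X ∩ Ici β)
    obtain ⟨hγX, hβγ⟩ : γ ∈ X ∩ Ici β := csInf_mem hne
    have hmin : ∀ x ∈ X, x < γ → x < β := fun x hx hxγ ↦ by
      by_contra! h
      exact (csInf_le' (s := X ∩ Ici β) ⟨hx, h⟩).not_gt hxγ
    obtain hβγ | hβγ := (mem_Ici.1 hβγ).eq_or_lt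
    · rwa [hβγ]
    exfalso
    have hγ3 : γ < omega3 := hX₁ hγX
    have hγ0 : γ ≠ 0 := (zero_le.trans_lt hβγ).ne'
    obtain hγc | hγc := le_or_gt γ.cof (ℵ_ 1)
    · obtain ⟨δ, hδX, hδγ, hβδ⟩ := hcofinal hX₁ hX₂ hX₃ γ hγX hγ0 hγc β hβγ
      exact (hmin δ hδX hδγ).not_ge hβδ
    have hγc : γ.cof = ℵ_ 2 := by
      apply le_antisymm
      · have h : γ.card < ℵ_ 3 := lt_ord.1 hγ3
        rw [← two_add_one_eq_three, ← succ_aleph, lt_succ_iff] at h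
        exact (Ordinal.cof_le_card γ).trans h
      · rw [← one_add_one_eq_two, ← succ_aleph]
        exact succ_le_of_lt hγc
    obtain ⟨f, hfβ, hf⟩ := exists_countable_cofinal hβc
    choose g hgX hfg hgβ using fun n ↦ hlim (f n) (hfβ n)
    obtain ⟨j, hji, hj⟩ := exists_bound_of_countable (o := i) (s := range fun n ↦ e γ (g n))
      (by rw [hcof]; exact aleph0_lt_aleph_one) (countable_range _) (by
        rintro _ ⟨n, rfl⟩
        exact (hmem hX₁ hX₂ hX₃ γ hγX _ ((hgβ n).trans hβγ)).2 (hgX n))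
    obtain ⟨hp₁, hp₂⟩ := hp' γ hγ3 hγc j (hji.trans hi)
    have hpX : p γ j ∈ X := hX₂ 3 γ hγX j ((hX₃ j (hji.trans hi)).2 hji)
    obtain ⟨n, hn⟩ := hf _ (hmin _ hpX hp₁)
    exact (hp₂ (g n) ((hgβ n).trans hβγ) (hj _ ⟨n, rfl⟩)).not_ge (hn.trans (hfg n).le)

/-- `f` is the rank function of the relation `γ ∈ A α`. -/
structure IsRank (A : Ordinal.{0} → Set Ordinal.{0}) (f : Ordinal.{0} → Ordinal.{0}) : Prop where
  lt : ∀ α, ∀ γ ∈ A α, γ < α → f γ < f α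
  exists_le : ∀ α, ∀ δ < f α, ∃ γ ∈ A α, δ ≤ f γ

theorem exists_rank (A : Ordinal.{0} → Set Ordinal.{0}) : ∃ f, IsRank A f := by
  let f : Ordinal.{0} → Ordinal.{0} := WellFoundedLT.fix fun α f ↦
    ⨆ γ : {γ : Iio α // γ.1 ∈ A α}, f γ.1 γ.1.2 + 1
  have hf : ∀ α, f α = ⨆ γ : {γ : Iio α // γ.1 ∈ A α}, f γ.1 + 1 := fun α ↦ by
    simp only [f]; rw [WellFoundedLT.fix_eq]
  refine ⟨f, fun α γ hγ hγα ↦ ?_, fun α δ hδ ↦ ?_⟩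
  · rw [hf α]
    exact Ordinal.lt_iSup_add_one (fun γ : {γ : Iio α // γ.1 ∈ A α} ↦ f γ.1) ⟨⟨γ, hγα⟩, hγ⟩
  · rw [hf α, Ordinal.lt_iSup_iff] at hδ
    obtain ⟨γ, hγ⟩ := hδ
    exact ⟨γ.1, γ.2, lt_succ_iff.1 hγ⟩

namespace CoherentSystem

variable {N : Set Ordinal.{0}} {A : Ordinal.{0} → Set Ordinal.{0}} {f : Ordinal.{0} → Ordinal.{0}}
  {α : Ordinal.{0}}

theorem rank_lt (h : CoherentSystem N A) (hf : IsRank A f) (hα : α < omega3) :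
    f α < (ℵ_ 2).ord := by
  induction α using WellFoundedLT.induction with
  | ind α ih =>
    obtain ⟨i, hi, d, hd⟩ := h.small α hα
    classical
    have hb : ⨆ ξ : Iio i, (if d ξ ∈ A α then f (d ξ) else 0) + 1 < (ℵ_ 2).ord := by
      refine iSup_Iio_add_one_lt ?_ fun ξ ↦ ?_
      · rw [isRegular_aleph_two.cof_ord]; exact lt_ord.1 hi
      · split_ifs with hξ
        · have := h.subset_Iio α hξ
          exact ih _ this (lt_trans this hα)
        · exact isRegular_aleph_two.ord_pos
    refine lt_of_le_of_lt ?_ hb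
    by_contra! hlt
    obtain ⟨γ, hγ, hle⟩ := hf.exists_le α _ hlt
    obtain ⟨ξ, hξ, rfl⟩ := hd hγ
    refine hle.not_gt (lt_of_eq_of_lt ?_ (Ordinal.lt_iSup_add_one _ (⟨ξ, hξ⟩ : Iio i)))
    simp [hγ]

theorem exists_rank_eq (h : CoherentSystem N A) (hf : IsRank A f) (hα : α ∈ N)
    {δ : Ordinal.{0}} (hδ : δ < f α) : ∃ γ ∈ A α, f γ = δ := by
  have hne : {γ ∈ A α | δ ≤ f γ}.Nonempty := hf.exists_le α δ hδ
  obtain ⟨hγ, hle⟩ := csInf_mem hne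
  set γ := sInf {γ ∈ A α | δ ≤ f γ}
  refine ⟨γ, hγ, hle.antisymm' ?_⟩
  by_contra! hlt
  obtain ⟨γ', hγ', hle'⟩ := hf.exists_le γ δ hlt
  rw [h.coherent α hα γ hγ] at hγ'
  exact (csInf_le' (s := {γ ∈ A α | δ ≤ f γ}) ⟨hγ'.1, hle'⟩).not_gt hγ'.2

theorem strictMonoOn_rank (h : CoherentSystem N A) (hf : IsRank A f) (hα : α ∈ N) :
    StrictMonoOn f (A α) := fun γ hγ γ' hγ' hlt ↦
  hf.lt γ' γ (by rw [h.coherent α hα γ' hγ']; exact ⟨hγ, hlt⟩) hlt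

theorem mem_of_countable (h : CoherentSystem N A) (hα : α ∈ N) (hα3 : α < omega3)
    {s : Set Ordinal.{0}} (hs : s.Countable) (hsA : s ⊆ A α) {β : Ordinal.{0}} (hβα : β < α)
    (hβ0 : β ≠ 0) (hβ : UnbddIn s β) : β ∈ A α :=
  h.closed α hα hα3 β hβα (cof_eq_aleph0_of_countable hβ0 hs hβ) fun b hb ↦
    let ⟨γ, hγ, hγ'⟩ := hβ b hb
    ⟨γ, hsA hγ, hγ'⟩

theorem exists_gt (h : CoherentSystem N A) (hα : α ∈ N) (hα3 : α < omega3)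
    (hlim : IsSuccLimit α) (hcof : α.cof ≤ ℵ_ 1) {β : Ordinal.{0}} (hβ : β < α) :
    ∃ γ ∈ A α, β < γ := by
  obtain ⟨γ, hγ, hle⟩ := h.cofinal α hα hα3 hlim.ne_bot hcof _ (hlim.succ_lt hβ)
  exact ⟨γ, hγ, (lt_succ β).trans_le hle⟩

theorem cof_eq_aleph0_of_rank (h : CoherentSystem N A) (hf : IsRank A f) (hα : α ∈ N)
    (hα3 : α < omega3) {β : Ordinal.{0}} (hβ : β ∈ A α) {E : Set Ordinal.{0}} (hE : E.Countable)
    (hβE : UnbddIn E (f β)) (hβ0 : f β ≠ 0) : β.cof = ℵ₀ := by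
  have hβN := h.mem α hα β hβ
  have hmono := h.strictMonoOn_rank hf hβN
  have hAβ := h.subset_Iio β
  set s := A β ∩ f ⁻¹' E
  have hs : s.Countable := MapsTo.countable_of_injOn (f := f) (fun γ hγ ↦ hγ.2)
    (hmono.injOn.mono inter_subset_left) hE
  have hsup : ∀ γ ∈ A β, ∃ γ' ∈ s, γ < γ' := fun γ hγ ↦ by
    obtain ⟨e, he, hγe, heβ⟩ := hβE _ (hf.lt β γ hγ (hAβ hγ))
    obtain ⟨γ', hγ', rfl⟩ := h.exists_rank_eq hf hβN heβ
    exact ⟨γ', ⟨hγ', he⟩, (hmono.lt_iff_lt hγ hγ').1 hγe⟩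
  have hne : (A β).Nonempty := by
    obtain ⟨γ, hγ, -⟩ := h.exists_rank_eq hf hβN (pos_iff_ne_zero.2 hβ0)
    exact ⟨γ, hγ⟩
  have hbdd : BddAbove s := ⟨β, fun γ hγ ↦ (hAβ hγ.1).le⟩
  have hle : sSup s ≤ β :=
    csSup_le' fun γ hγ ↦ (hAβ hγ.1).le
  have hub : UnbddIn s (sSup s) := fun b hb ↦ by
    obtain ⟨γ, hγ, hbγ⟩ := exists_lt_of_lt_csSup' hb
    obtain ⟨γ', hγ', hlt⟩ := hsup γ hγ.1
    exact ⟨γ, hγ, hbγ, hlt.trans_le (le_csSup hbdd hγ')⟩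
  have h0 : sSup s ≠ 0 := by
    obtain ⟨γ, hγ⟩ := hne
    obtain ⟨γ', hγ', hlt⟩ := hsup γ hγ
    exact (zero_le.trans_lt (hlt.trans_le (le_csSup hbdd hγ'))).ne'
  obtain hlt | heq := hle.lt_or_eq
  · have hmem := h.mem_of_countable hβN ((h.subset_Iio α hβ).trans hα3) hs inter_subset_left
      hlt h0 hub
    obtain ⟨γ', hγ', hlt'⟩ := hsup _ hmem
    exact ((le_csSup hbdd hγ').not_gt hlt').elim
  · rw [← heq]
    exact cof_eq_aleph0_of_countable h0 hs hub

theorem exists_cofinal_rank (h : CoherentSystem N A) (hf : IsRank A f) (hα : α ∈ N)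
    (hα3 : α < omega3) (hcof : α.cof = ℵ_ 1) : ∃ E ⊆ Iio (f α),
    (∀ η < f α, ∃ e ∈ E, η < e) ∧ ∀ ξ < f α, (E ∩ Iic ξ).Countable := by
  have hlim : IsSuccLimit α := by
    rw [← Ordinal.one_lt_cof_iff, hcof]
    exact one_lt_aleph0.trans aleph0_lt_aleph_one
  obtain ⟨a, ha⟩ := exists_isFundamentalSeq (o := α) (a := (ℵ_ 1).ord) (by rw [hcof])
  have hgt : ∀ β < α, ∃ ν, β < (a ν).1 := fun β hβ ↦ by
    obtain ⟨_, ⟨ν, rfl⟩, hν⟩ := ha.isCofinal_range ⟨_, hlim.succ_lt hβ⟩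
    exact ⟨ν, (lt_succ β).trans_le hν⟩
  choose m hmA hm using fun ν ↦ h.exists_gt hα hα3 hlim hcof.le (a ν).2
  have hmono := h.strictMonoOn_rank hf hα
  refine ⟨range (f ∘ m), ?_, fun η hη ↦ ?_, fun ξ hξ ↦ ?_⟩
  · rintro _ ⟨ν, rfl⟩
    exact hf.lt α _ (hmA ν) (h.subset_Iio α (hmA ν))
  · obtain ⟨γ, hγ, rfl⟩ := h.exists_rank_eq hf hα hη
    obtain ⟨ν, hν⟩ := hgt γ (h.subset_Iio α hγ)
    exact ⟨_, ⟨ν, rfl⟩, hmono hγ (hmA ν) (hν.trans (hm ν))⟩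
  · obtain ⟨β, hβ, rfl⟩ := h.exists_rank_eq hf hα hξ
    obtain ⟨ν₀, hν₀⟩ := hgt β (h.subset_Iio α hβ)
    have : (Iio ν₀).Countable := by
      have : (Iio ν₀.1).Countable := by
        rw [← le_aleph0_iff_set_countable, Cardinal.mk_Iio_ordinal, Cardinal.lift_le_aleph0,
          ← lt_succ_iff, succ_aleph0]
        exact lt_ord.1 ν₀.2
      exact MapsTo.countable_of_injOn (f := Subtype.val) (t := Iio ν₀.1) (fun ν hν ↦ hν)
        Subtype.val_injective.injOn this
    refine (this.image (f ∘ m)).mono ?_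
    rintro _ ⟨⟨ν, rfl⟩, hν⟩
    refine ⟨ν, ?_, rfl⟩
    have h₁ : m ν ≤ β := (hmono.le_iff_le (hmA ν) hβ).1 hν
    exact ha.strictMono.lt_iff_lt.1 (((hm ν).trans_le h₁).trans hν₀)

theorem exists_bound_rank (h : CoherentSystem N A) (hf : IsRank A f) (hα : α ∈ N)
    (hα3 : α < omega3) (hcof : α.cof = ℵ_ 1) {Q : Set Ordinal.{0}} (hQ : Q.Countable)
    (hQα : Q ⊆ Iio (f α)) : ∃ b < f α, ∀ x ∈ Q, x < b := by
  have hlim : IsSuccLimit α := by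
    rw [← Ordinal.one_lt_cof_iff, hcof]
    exact one_lt_aleph0.trans aleph0_lt_aleph_one
  have hmono := h.strictMonoOn_rank hf hα
  obtain ⟨b, hb, hb'⟩ := exists_bound_of_countable (o := α) (s := A α ∩ f ⁻¹' Q)
    (by rw [hcof]; exact aleph0_lt_aleph_one)
    (MapsTo.countable_of_injOn (f := f) (fun γ hγ ↦ hγ.2) (hmono.injOn.mono inter_subset_left) hQ)
    fun x hx ↦ h.subset_Iio α hx.1
  obtain ⟨γ, hγ, hbγ⟩ := h.exists_gt hα hα3 hlim hcof.le hb
  refine ⟨f γ, hf.lt α γ hγ (h.subset_Iio α hγ), fun x hx ↦ ?_⟩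
  obtain ⟨γ', hγ', rfl⟩ := h.exists_rank_eq hf hα (hQα hx)
  exact hmono hγ' hγ ((hb' γ' ⟨hγ', hx⟩).trans hbγ)

end CoherentSystem

theorem exists_thin_club {ε : Ordinal.{0}} (hε : 0 < ε) {E : Set Ordinal.{0}} (hEε : E ⊆ Iio ε)
    (hE : ∀ η < ε, ∃ e ∈ E, η < e) (hEc : ∀ ξ < ε, (E ∩ Iic ξ).Countable)
    (hb : ∀ Q : Set Ordinal.{0}, Q.Countable → Q ⊆ Iio ε → ∃ b < ε, ∀ x ∈ Q, x < b)
    (δ : Ordinal.{0}) :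
    ∃ D ⊆ Iio ε, δ ∉ D ∧ 0 ∉ D ∧ (∀ η < ε, ∃ ξ ∈ D, η < ξ) ∧
      (∀ ξ < ε, (D ∩ Iio ξ).Countable) ∧ (∀ ξ < ε, ξ ≠ 0 → UnbddIn D ξ → ξ ∈ D) ∧
      ∀ ξ ∈ D, ∃ Q : Set Ordinal.{0}, Q.Countable ∧ UnbddIn Q ξ := by
  obtain ⟨η₀, hη₀, hδ⟩ : ∃ η₀ < ε, δ < ε → δ ≤ η₀ := by
    by_cases h : δ < ε
    · exact ⟨δ, h, fun _ ↦ le_rfl⟩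
    · exact ⟨0, hε, fun h' ↦ (h h').elim⟩
  have hex : ∀ η, ∃ e, η < ε → e ∈ E ∧ η < e := fun η ↦ by
    by_cases h : η < ε
    · obtain ⟨e, he⟩ := hE η h
      exact ⟨e, fun _ ↦ he⟩
    · exact ⟨0, fun h' ↦ (h h').elim⟩
  choose nx hnx using hex
  refine ⟨{ξ | ξ < ε ∧ η₀ < ξ ∧ UnbddIn E ξ}, fun ξ hξ ↦ hξ.1, ?_, ?_, ?_, ?_, ?_, ?_⟩
  · exact fun h ↦ (hδ h.1).not_gt h.2.1
  · exact fun h ↦ not_lt_zero h.2.1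
  · intro η hη
    let s : ℕ → Ordinal.{0} := fun n ↦ nx^[n] (max η η₀)
    have hs : ∀ n, s n < ε := fun n ↦ by
      induction n with
      | zero => exact max_lt hη hη₀
      | succ n ih =>
        simp only [s, Function.iterate_succ_apply']
        exact hEε (hnx _ ih).1
    have hs' : ∀ n, s (n + 1) ∈ E ∧ s n < s (n + 1) := fun n ↦ by
      simp only [s, Function.iterate_succ_apply']
      exact hnx _ (hs n)
    obtain ⟨b, hbε, hb⟩ := hb (range s) (countable_range s) (by rintro _ ⟨n, rfl⟩; exact hs n)
    have hlt : ∀ n, s n < ⨆ n, s n := fun n ↦ (hs' n).2.trans_le (Ordinal.le_iSup s _)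
    refine ⟨⨆ n, s n, ⟨?_, ?_, ?_⟩, ?_⟩
    · exact (Ordinal.iSup_le fun n ↦ (hb _ ⟨n, rfl⟩).le).trans_lt hbε
    · exact (le_max_right η η₀).trans_lt (hlt 0)
    · intro x hx
      obtain ⟨n, hn⟩ := Ordinal.lt_iSup_iff.1 hx
      exact ⟨_, (hs' n).1, hn.trans (hs' n).2, hlt _⟩
    · exact (le_max_left η η₀).trans_lt (hlt 0)
  · intro ξ hξ
    let g : Ordinal.{0} → Ordinal.{0} := fun d ↦ sInf {e ∈ E | d < e}
    have hg : ∀ d < ε, g d ∈ E ∧ d < g d := fun d hd ↦ csInf_mem (hE d hd)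
    have hgle : ∀ d, ∀ e ∈ E, d < e → g d ≤ e := fun d e he hde ↦ csInf_le' ⟨he, hde⟩
    refine MapsTo.countable_of_injOn (f := g) (t := E ∩ Iic (g ξ)) ?_ ?_
      (hEc _ (hEε (hg ξ hξ).1))
    · rintro d ⟨⟨hd, -, -⟩, hdξ⟩
      exact ⟨(hg d hd).1, hgle d _ (hg ξ hξ).1 (hdξ.trans (hg ξ hξ).2)⟩
    · refine StrictMonoOn.injOn ?_
      rintro d ⟨⟨hd, -, -⟩, hdξ⟩ d' ⟨⟨hd', -, hd'E⟩, -⟩ hlt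
      obtain ⟨e, he, hde, hed⟩ := hd'E d hlt
      exact (hgle d e he hde).trans_lt (hed.trans (hg d' hd').2)
  · intro ξ hξ hξ0 hD
    refine ⟨hξ, ?_, fun η hη ↦ ?_⟩
    · obtain ⟨d, hd, -, hdξ⟩ := hD 0 (pos_iff_ne_zero.2 hξ0)
      exact hd.2.1.trans hdξ
    · obtain ⟨d, hd, hηd, hdξ⟩ := hD η hη
      obtain ⟨e, he, h₁, h₂⟩ := hd.2.2 η hηd
      exact ⟨e, he, h₁, h₂.trans hdξ⟩
  · rintro ξ ⟨hξ, -, hξE⟩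
    refine ⟨E ∩ Iic ξ, hEc ξ hξ, fun η hη ↦ ?_⟩
    obtain ⟨e, he, h₁, h₂⟩ := hξE η hη
    exact ⟨e, ⟨he, h₂.le⟩, h₁, h₂⟩

theorem otype_le_omega1 {C : Set Ordinal.{0}} (hC : ∀ β ∈ C, (C ∩ Iio β).Countable) :
    otype C ≤ Ordinal.lift.{1, 0} omega1 := by
  by_contra! h
  let r : C → C → Prop := (· < ·)
  have h' : Ordinal.lift.{1, 0} omega1 < Ordinal.type r := h
  set β : C := Ordinal.enum r ⟨_, h'⟩
  have hβ : typein r β = Ordinal.lift.{1, 0} omega1 := typein_enum r h'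
  have hcard : (typein r β).card = Cardinal.lift.{1, 0} (ℵ_ 1) := by
    rw [hβ, ← lift_card, omega1, card_ord]
  have hc : #{x : C // r x β} ≤ ℵ₀ := by
    rw [mk_le_aleph0_iff]
    have := (hC β.1 β.2).to_subtype
    exact Function.Injective.countable (β := ↥(C ∩ Iio β.1))
      (f := fun x : {x : C // r x β} ↦ ⟨x.1.1, x.1.2, x.2⟩)
      fun x y hxy ↦ Subtype.ext (Subtype.ext (congrArg (fun z : ↥(C ∩ Iio β.1) ↦ z.1) hxy))
  have : Cardinal.lift.{1, 0} (ℵ_ 1) ≤ ℵ₀ := hcard ▸ hc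
  exact (Cardinal.lift_le_aleph0.1 this).not_gt aleph0_lt_aleph_one

namespace CoherentSystem

variable {N : Set Ordinal.{0}} {A : Ordinal.{0} → Set Ordinal.{0}} {f : Ordinal.{0} → Ordinal.{0}}
  {α ε : Ordinal.{0}} {D : Set Ordinal.{0}}

theorem countable_rank_preimage_inter_Iio (h : CoherentSystem N A) (hf : IsRank A f) (hα : α ∈ N)
    (hαε : f α ≤ ε) (hDc : ∀ ξ < ε, (D ∩ Iio ξ).Countable) {γ : Ordinal.{0}} (hγ : γ ∈ A α) :
    ({β ∈ A α | f β ∈ D} ∩ Iio γ).Countable := by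
  have hmono := h.strictMonoOn_rank hf hα
  refine MapsTo.countable_of_injOn (f := f) (t := D ∩ Iio (f γ)) ?_
    (hmono.injOn.mono fun β hβ ↦ hβ.1.1)
    (hDc _ ((hf.lt α γ hγ (h.subset_Iio α hγ)).trans_le hαε))
  rintro β ⟨⟨hβ, hβD⟩, hβγ⟩
  exact ⟨hβD, hmono hβ hγ hβγ⟩

theorem closedSupIn_rank_preimage (h : CoherentSystem N A) (hf : IsRank A f) (hα : α ∈ N)
    (hα3 : α < omega3) (hlim : IsSuccLimit α) (hcof : α.cof ≤ ℵ_ 1) (hαε : f α ≤ ε)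
    (hDc : ∀ ξ < ε, (D ∩ Iio ξ).Countable)
    (hDcl : ∀ ξ < ε, ξ ≠ 0 → UnbddIn D ξ → ξ ∈ D) :
    ClosedSupIn {β ∈ A α | f β ∈ D} α := by
  rintro s hs ⟨x, hx⟩ ⟨b, hb, hsb⟩
  by_cases hmem : sSup s ∈ s
  · exact hs hmem
  have hbdd : BddAbove s := ⟨b, hsb⟩
  have hlt : ∀ y ∈ s, y < sSup s := fun y hy ↦
    (le_csSup hbdd hy).lt_of_ne fun heq ↦ hmem (heq ▸ hy)
  have hub : UnbddIn s (sSup s) := fun c hc ↦ by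
    obtain ⟨y, hy, hcy⟩ := exists_lt_of_lt_csSup' hc
    exact ⟨y, hy, hcy, hlt y hy⟩
  have hle : sSup s ≤ b := csSup_le' hsb
  obtain ⟨γ, hγ, hbγ⟩ := h.exists_gt hα hα3 hlim hcof hb
  have hsc : s.Countable := (h.countable_rank_preimage_inter_Iio hf hα hαε hDc hγ).mono
    (subset_inter hs fun y hy ↦ (hsb y hy).trans_lt hbγ)
  have hβA : sSup s ∈ A α := h.mem_of_countable hα hα3 hsc (fun y hy ↦ (hs hy).1)
    (hle.trans_lt hb) (zero_le.trans_lt (hlt x hx)).ne' hub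
  have hmono := h.strictMonoOn_rank hf hα
  refine ⟨hβA, hDcl _ ((hf.lt α _ hβA (hle.trans_lt hb)).trans_le hαε)
    (zero_le.trans_lt (hmono (hs hx).1 hβA (hlt x hx))).ne' fun η hη ↦ ?_⟩
  obtain ⟨γ', hγ', rfl⟩ := h.exists_rank_eq hf (h.mem α hα _ hβA) hη
  rw [h.coherent α hα _ hβA] at hγ'
  obtain ⟨t, ht, hγt, htβ⟩ := hub γ' hγ'.2
  exact ⟨f t, (hs ht).2, hmono hγ'.1 (hs ht).1 hγt, hmono (hs ht).1 hβA htβ⟩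

theorem exists_gt_rank_preimage (h : CoherentSystem N A) (hf : IsRank A f) (hα : α ∈ N)
    (hα3 : α < omega3) (hlim : IsSuccLimit α) (hcof : α.cof ≤ ℵ_ 1)
    (hDα : D ⊆ Iio (f α)) (hD : ∀ η < f α, ∃ ξ ∈ D, η < ξ) {β : Ordinal.{0}} (hβ : β < α) :
    ∃ γ ∈ {γ ∈ A α | f γ ∈ D}, β < γ := by
  obtain ⟨γ, hγ, hβγ⟩ := h.exists_gt hα hα3 hlim hcof hβ
  obtain ⟨ξ, hξ, hlt⟩ := hD _ (hf.lt α γ hγ (h.subset_Iio α hγ))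
  obtain ⟨γ', hγ', rfl⟩ := h.exists_rank_eq hf hα (hDα hξ)
  exact ⟨γ', ⟨hγ', hξ⟩, hβγ.trans (((h.strictMonoOn_rank hf hα).lt_iff_lt hγ hγ').1 hlt)⟩

end CoherentSystem

theorem StationaryIn.nonempty {X : Set Ordinal.{0}} (hX : StationaryIn X omega3) : X.Nonempty :=
  (hX (Iio omega3) subset_rfl (fun _ hα _ _ ↦ hα) fun β hβ ↦
    have := (isSuccLimit_ord (aleph0_le_aleph 3)).succ_lt hβ
    ⟨succ β, this, lt_succ β, this⟩).left

theorem exists_stationaryIn_rank : ∃ (N : Set Ordinal.{0}) (A : Ordinal.{0} → Set Ordinal.{0})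
    (f : Ordinal.{0} → Ordinal.{0}) (ε δ : Ordinal.{0}), CoherentSystem N A ∧ IsRank A f ∧
      StationaryIn {α | α ∈ S31 ∧ α ∈ N ∧ f α = ε} omega3 ∧
      StationaryIn {α | α ∈ S30 ∧ f α = δ} omega3 := by
  obtain ⟨N, A, hNA⟩ := exists_coherentSystem
  choose f hf using fun i ↦ exists_rank (A i)
  let v : (ℵ_ 2).ord.ToType → Ordinal.{0} := fun x ↦ (ToType.mk.symm x).1
  have hv : ∀ ξ < (ℵ_ 2).ord, ∃ x, v x = ξ := fun ξ hξ ↦ ⟨ToType.mk ⟨ξ, hξ⟩, by simp [v]⟩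
  have hcard : #(ℵ_ 2).ord.ToType = ℵ_ 2 := by simp
  have hlt : ∀ {a : Ordinal.{0}}, a < 3 → ℵ_ a < ℵ_ 3 := aleph_lt_aleph.2
  obtain ⟨⟨x, y⟩, hxy⟩ := exists_stationaryIn_of_cover
    (ι := (ℵ_ 2).ord.ToType × (ℵ_ 2).ord.ToType)
    (by rw [← mul_def, hcard, mul_eq_self isRegular_aleph_two.aleph0_le])
    isRegular_aleph_one (hlt (by norm_num))
    (fun p ↦ {α | (α ∈ N (v p.1) ∧ f (v p.1) α = v p.2) ∧ CoherentSystem (N (v p.1)) (A (v p.1))})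
    (fun α hα hα2 _ ↦ by
      obtain ⟨i, hi, hαi, h⟩ := hNA α hα hα2
      obtain ⟨x, rfl⟩ := hv i hi
      obtain ⟨y, hy⟩ := hv _ (h.rank_lt (hf (v x)) hα)
      exact ⟨(x, y), ⟨hαi, hy.symm⟩, h⟩)
  obtain ⟨α, -, -, h⟩ := hxy.nonempty
  obtain ⟨z, hz⟩ := exists_stationaryIn_of_cover hcard.le isRegular_aleph0
    (aleph0_lt_aleph_one.trans (hlt (by norm_num))) (fun z ↦ {α | f (v x) α = v z})
    (fun α hα _ _ ↦ by
      obtain ⟨z, hz⟩ := hv _ (h.rank_lt (hf (v x)) hα)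
      exact ⟨z, hz.symm⟩)
  refine ⟨N (v x), A (v x), f (v x), v y, v z, h, hf _, ?_, hz⟩
  convert hxy using 1
  ext α
  exact ⟨fun hα ↦ ⟨hα.1, hα.2, h⟩, fun hα ↦ ⟨hα.1, hα.2.1⟩⟩

theorem stmt13 :
    ∃ (S U : Set Ordinal.{0}) (C : ∀ α ∈ S, Set Ordinal.{0}),
      (S ⊆ S30 ∪ S31 ∧ StationaryIn (S ∩ S31) omega3) ∧
      (U ⊆ S30 ∧ StationaryIn U omega3 ∧ S ∩ U = ∅) ∧
      (∀ α (hα : α ∈ S), C α hα ⊆ Set.Iio α ∩ S ∧ ClosedSupIn (C α hα) α ∧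
        otype (C α hα) ≤ Ordinal.lift.{1,0} omega1) ∧
      (∀ α (hα : α ∈ S), ∀ β ∈ C α hα, ∀ hβ : β ∈ S, C β hβ = C α hα ∩ Set.Iio β) ∧
      (∀ α (hα : α ∈ S), α ∈ S31 → ∀ β < α, ∃ γ ∈ C α hα, β < γ) := by
  obtain ⟨N, A, f, ε, δ, h, hf, hS, hU⟩ := exists_stationaryIn_rank
  obtain ⟨α₀, ⟨hα₀3, hα₀c⟩, hα₀, rfl⟩ := hS.nonempty
  have hlim : ∀ {α : Ordinal.{0}}, ℵ₀ ≤ α.cof → IsSuccLimit α := fun hα ↦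
    Ordinal.one_lt_cof_iff.1 (one_lt_aleph0.trans_le hα)
  have hε : 0 < f α₀ := by
    have hα₀l := hlim (hα₀c ▸ aleph0_lt_aleph_one.le)
    obtain ⟨γ, hγ, -⟩ := h.exists_gt hα₀ hα₀3 hα₀l hα₀c.le hα₀l.bot_lt
    exact zero_le.trans_lt (hf.lt _ γ hγ (h.subset_Iio _ hγ))
  obtain ⟨E, hEε, hE, hEc⟩ := h.exists_cofinal_rank hf hα₀ hα₀3 hα₀c
  obtain ⟨D, hDε, hδ, hD0, hD, hDc, hDcl, hDcof⟩ := exists_thin_club hε hEε hE hEc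
    (fun Q ↦ h.exists_bound_rank hf hα₀ hα₀3 hα₀c) δ
  set ε := f α₀
  have h01 : ∀ α, α ∈ S30 → α ∉ S31 := fun α h₀ h₁ ↦
    aleph0_lt_aleph_one.ne (h₀.2.symm.trans h₁.2)
  set S : Set Ordinal.{0} := {α | α ∈ N ∧ (α ∈ S30 ∧ f α ∈ D ∨ α ∈ S31 ∧ f α = ε)}
  have hSN : ∀ α ∈ S, α ∈ N ∧ α < omega3 ∧ IsSuccLimit α ∧ α.cof ≤ ℵ_ 1 ∧ f α ≤ ε := by
    rintro α ⟨hα, ⟨⟨h3, hc⟩, hαD⟩ | ⟨⟨h3, hc⟩, hαε⟩⟩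
    · exact ⟨hα, h3, hlim hc.ge, hc.trans_le aleph0_lt_aleph_one.le, (hDε hαD).le⟩
    · exact ⟨hα, h3, hlim (hc ▸ aleph0_lt_aleph_one.le), hc.le, hαε.le⟩
  refine ⟨S, {α | α ∈ S30 ∧ f α = δ}, fun α _ ↦ {β ∈ A α | f β ∈ D}, ⟨?_, ?_⟩,
    ⟨fun α hα ↦ hα.1, hU, ?_⟩, ?_, ?_, ?_⟩
  · rintro α ⟨-, hα | hα⟩
    exacts [.inl hα.1, .inr hα.1]
  · intro C hC₁ hC₂ hC₃
    obtain ⟨α, hα, hαC⟩ := hS C hC₁ hC₂ hC₃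
    exact ⟨α, ⟨⟨hα.2.1, .inr ⟨hα.1, hα.2.2⟩⟩, hα.1⟩, hαC⟩
  · refine eq_empty_of_forall_notMem ?_
    rintro α ⟨⟨-, hα | hα⟩, hα0, rfl⟩
    exacts [hδ hα.2, h01 α hα0 hα.1]
  · intro α hα
    obtain ⟨hαN, hα3, hαl, hαc, hαε⟩ := hSN α hα
    refine ⟨fun β hβ ↦ ⟨h.subset_Iio α hβ.1, h.mem α hαN β hβ.1, .inl ⟨⟨?_, ?_⟩, hβ.2⟩⟩,
      h.closedSupIn_rank_preimage hf hαN hα3 hαl hαc hαε hDc hDcl,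
      otype_le_omega1 fun β hβ ↦ h.countable_rank_preimage_inter_Iio hf hαN hαε hDc hβ.1⟩
    · exact (h.subset_Iio α hβ.1).trans hα3
    · obtain ⟨Q, hQ, hQβ⟩ := hDcof _ hβ.2
      exact h.cof_eq_aleph0_of_rank hf hαN hα3 hβ.1 hQ hQβ (ne_of_mem_of_not_mem hβ.2 hD0)
  · intro α hα β hβ _
    ext γ
    simp only [h.coherent α (hSN α hα).1 β hβ.1, mem_inter_iff, mem_ofPred_eq, and_right_comm]
  · intro α hα hα1 β hβ
    obtain ⟨hαN, hα3, hαl, hαc, -⟩ := hSN α hα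
    have hαε : f α = ε := hα.2.elim (fun h₀ ↦ (h01 α h₀.1 hα1).elim) And.right
    exact h.exists_gt_rank_preimage hf hαN hα3 hαl hαc (hαε ▸ hDε) (hαε ▸ hD) hβ
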